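/- Let R ≥ 4, ‖A‖ ≤ R (spectral norm), ‖x‖_2 ≤ R, ‖y‖_2 ≤ R, β ∈ (0, 0.1), and suppose ⟨exp(Ax) + Ax, 1_n⟩ ≥ β and ⟨exp(Ay) + Ay, 1_n⟩ ≥ β. Then |α(x)^{-2} − α(y)^{-2}| ≤ 4β^{-3}·√n·R·exp(R²)·‖x − y‖_2, where α(x) = ⟨exp(Ax) + Ax, 1_n⟩. -/

import Mathlib

open Matrix

/-- Euclidean (ℓ₂) norm of a vector in ℝ^m. -/
noncomputable def vecNorm2 {m : ℕ} (v : Fin m → ℝ) : ℝ := Real.sqrt (∑ i, (v i) ^ 2)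

/-- ℓ₁ norm of a vector in ℝ^m. -/
noncomputable def vecNorm1 {m : ℕ} (v : Fin m → ℝ) : ℝ := ∑ i, |v i|

/-- Spectral norm of a matrix: operator norm of the induced map between Euclidean spaces. -/
noncomputable def specNorm {m k : ℕ} (A : Matrix (Fin m) (Fin k) ℝ) : ℝ :=
  ‖(Matrix.toEuclideanLin A).toContinuousLinearMap‖

/-- Loewner order: `U ⪯ V` iff `vᵀ U v ≤ vᵀ V v` for all vectors `v`. -/
def loewnerLE {m : ℕ} (U V : Matrix (Fin m) (Fin m) ℝ) : Prop :=
  ∀ v : Fin m → ℝ, v ⬝ᵥ (U *ᵥ v) ≤ v ⬝ᵥ (V *ᵥ v)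

variable {n d : ℕ}

/-- `exp(Ax)`, the entrywise exponential of `A x`. -/
noncomputable def expv (A : Matrix (Fin n) (Fin d) ℝ) (x : Fin d → ℝ) : Fin n → ℝ :=
  fun j => Real.exp (A.mulVec x j)

/-- `u(x) = exp(Ax) + Ax`. -/
noncomputable def uf (A : Matrix (Fin n) (Fin d) ℝ) (x : Fin d → ℝ) : Fin n → ℝ :=
  fun j => expv A x j + A.mulVec x j

/-- `α(x) = ⟨u(x), 1_n⟩`. -/
noncomputable def alphaf (A : Matrix (Fin n) (Fin d) ℝ) (x : Fin d → ℝ) : ℝ :=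
  ∑ j, uf A x j

/-- `f(x) = α(x)⁻¹ u(x)`. -/
noncomputable def ff (A : Matrix (Fin n) (Fin d) ℝ) (x : Fin d → ℝ) : Fin n → ℝ :=
  (alphaf A x)⁻¹ • uf A x

/-- `v_i(x) = (exp(Ax) + 1_n) ∘ A_{*,i}`. -/
noncomputable def vf (A : Matrix (Fin n) (Fin d) ℝ) (i : Fin d) (x : Fin d → ℝ) : Fin n → ℝ :=
  fun j => (expv A x j + 1) * A j i

/-- `c(x) = f(x) - b`. -/
noncomputable def cf (A : Matrix (Fin n) (Fin d) ℝ) (b : Fin n → ℝ) (x : Fin d → ℝ) : Fin n → ℝ :=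
  fun j => ff A x j - b j

/-- `L(x) = 0.5 ‖c(x)‖₂²`. -/
noncomputable def Lf (A : Matrix (Fin n) (Fin d) ℝ) (b : Fin n → ℝ) (x : Fin d → ℝ) : ℝ :=
  0.5 * ∑ j, (cf A b x j) ^ 2

/-- `z(x) = exp(Ax) + 1_n`. -/
noncomputable def zf (A : Matrix (Fin n) (Fin d) ℝ) (x : Fin d → ℝ) : Fin n → ℝ :=
  fun j => expv A x j + 1

/-- `K(x) = I_n - f(x) · 1_nᵀ`. -/
noncomputable def Kf (A : Matrix (Fin n) (Fin d) ℝ) (x : Fin d → ℝ) : Matrix (Fin n) (Fin n) ℝ :=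
  1 - vecMulVec (ff A x) (fun _ => 1)

/-- `c̃(x) = K(x)ᵀ c(x)`. -/
noncomputable def ctf (A : Matrix (Fin n) (Fin d) ℝ) (b : Fin n → ℝ) (x : Fin d → ℝ) : Fin n → ℝ :=
  (Kf A x)ᵀ *ᵥ cf A b x

/-- `B_mat(x) = α(x)⁻² diag(z(x)) K(x)ᵀ K(x) diag(z(x))`. -/
noncomputable def Bmat (A : Matrix (Fin n) (Fin d) ℝ) (x : Fin d → ℝ) : Matrix (Fin n) (Fin n) ℝ :=
  ((alphaf A x) ^ 2)⁻¹ • (diagonal (zf A x) * (Kf A x)ᵀ * Kf A x * diagonal (zf A x))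

/-- `B_rank(x) = α(x)⁻² (z(x) c̃(x)ᵀ diag(z(x)) + diag(z(x)) c̃(x) z(x)ᵀ)`. -/
noncomputable def Brank (A : Matrix (Fin n) (Fin d) ℝ) (b : Fin n → ℝ) (x : Fin d → ℝ) :
    Matrix (Fin n) (Fin n) ℝ :=
  ((alphaf A x) ^ 2)⁻¹ •
    (vecMulVec (zf A x) (ctf A b x) * diagonal (zf A x)
      + diagonal (zf A x) * vecMulVec (ctf A b x) (zf A x))

/-- `B_diag(x) = α(x)⁻¹ diag(c̃(x) ∘ exp(Ax))`. -/
noncomputable def Bdiag (A : Matrix (Fin n) (Fin d) ℝ) (b : Fin n → ℝ) (x : Fin d → ℝ) :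
    Matrix (Fin n) (Fin n) ℝ :=
  (alphaf A x)⁻¹ • diagonal (fun j => ctf A b x j * expv A x j)

/-- `B(x) = B_mat(x) - B_rank(x) + B_diag(x)`. -/
noncomputable def Bf (A : Matrix (Fin n) (Fin d) ℝ) (b : Fin n → ℝ) (x : Fin d → ℝ) :
    Matrix (Fin n) (Fin n) ℝ :=
  Bmat A x - Brank A b x + Bdiag A b x

/-- Hessian matrix of the loss `L`, with `H(x)_{ij} = ∂²L/∂x_i∂x_j`. -/
noncomputable def Hf (A : Matrix (Fin n) (Fin d) ℝ) (b : Fin n → ℝ) (x : Fin d → ℝ) :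
    Matrix (Fin d) (Fin d) ℝ :=
  Matrix.of fun i j =>
    fderiv ℝ (fun y => fderiv ℝ (Lf A b) y (Pi.single j 1)) x (Pi.single i 1)

theorem aux_vecNorm2 {m : ℕ} (v : Fin m → ℝ) : vecNorm2 v = ‖WithLp.toLp 2 v‖ := by
  rw [EuclideanSpace.norm_eq]
  simp [vecNorm2]

theorem aux_mulVec {n d : ℕ} (A : Matrix (Fin n) (Fin d) ℝ) (x : Fin d → ℝ) :
    vecNorm2 (A.mulVec x) ≤ specNorm A * vecNorm2 x := by
  rw [aux_vecNorm2, aux_vecNorm2]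
  have h := (Matrix.toEuclideanLin A).toContinuousLinearMap.le_opNorm (WithLp.toLp 2 x)
  exact h

theorem aux_coord {m : ℕ} (v : Fin m → ℝ) (j : Fin m) : v j ≤ vecNorm2 v := by
  unfold vecNorm2
  apply Real.le_sqrt_of_sq_le
  exact Finset.single_le_sum (f := fun i => (v i) ^ 2) (fun i _ => sq_nonneg _) (Finset.mem_univ j)

theorem aux_l1 {m : ℕ} (v : Fin m → ℝ) : ∑ i, |v i| ≤ Real.sqrt m * vecNorm2 v := by
  unfold vecNorm2
  rw [← Real.sqrt_mul (Nat.cast_nonneg m)]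
  apply Real.le_sqrt_of_sq_le
  have h := sq_sum_le_card_mul_sum_sq (s := (Finset.univ : Finset (Fin m))) (f := fun i => |v i|)
  simpa using h

theorem aux_exp (a b M : ℝ) (ha : a ≤ M) (hb : b ≤ M) :
    |Real.exp a - Real.exp b| ≤ Real.exp M * |a - b| := by
  wlog hab : b ≤ a generalizing a b
  · rw [abs_sub_comm, abs_sub_comm a b]
    exact this b a hb ha (le_of_not_ge hab)
  rw [abs_of_nonneg (sub_nonneg.2 (Real.exp_le_exp.2 hab)), abs_of_nonneg (sub_nonneg.2 hab)]
  have h1 := Real.add_one_le_exp (b - a)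
  have h2 : Real.exp b = Real.exp a * Real.exp (b - a) := by
    rw [← Real.exp_add]; ring_nf
  have h3 := Real.exp_le_exp.2 ha
  have h4 := Real.exp_pos a
  have h5 : Real.exp a * (a - b) ≤ Real.exp M * (a - b) :=
    mul_le_mul_of_nonneg_right h3 (sub_nonneg.2 hab)
  have h6 : Real.exp a * (b - a + 1) ≤ Real.exp a * Real.exp (b - a) :=
    mul_le_mul_of_nonneg_left h1 h4.le
  linarith

theorem aux_inv (a b β : ℝ) (hβ : 0 < β) (ha : β ≤ a) (hb : β ≤ b) :
    |(a ^ 2)⁻¹ - (b ^ 2)⁻¹| ≤ 2 * (β ^ 3)⁻¹ * |a - b| := by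
  have ha0 : 0 < a := hβ.trans_le ha
  have hb0 : 0 < b := hβ.trans_le hb
  have e : (a ^ 2)⁻¹ - (b ^ 2)⁻¹ = ((a * b ^ 2)⁻¹ + (a ^ 2 * b)⁻¹) * (b - a) := by
    field_simp
    ring
  have p1 : (a * b ^ 2)⁻¹ ≤ (β ^ 3)⁻¹ := by
    apply inv_anti₀ (by positivity)
    calc β ^ 3 = β * β ^ 2 := by ring
      _ ≤ a * b ^ 2 := by gcongr
  have p2 : (a ^ 2 * b)⁻¹ ≤ (β ^ 3)⁻¹ := by
    apply inv_anti₀ (by positivity)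
    calc β ^ 3 = β ^ 2 * β := by ring
      _ ≤ a ^ 2 * b := by gcongr
  rw [e, abs_mul, abs_sub_comm b a, abs_of_pos (by positivity)]
  gcongr
  linarith

/-- |α(x)⁻² − α(y)⁻²| ≤ 4β⁻³·√n·R·exp(R²)·‖x − y‖₂. -/
theorem stmt17 (n d : ℕ) (A : Matrix (Fin n) (Fin d) ℝ) (x y : Fin d → ℝ) (R β : ℝ)
    (hR : 4 ≤ R) (hA : specNorm A ≤ R) (hx : vecNorm2 x ≤ R) (hy : vecNorm2 y ≤ R)
    (hβ0 : 0 < β) (hβ1 : β < 0.1)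
    (hβx : β ≤ alphaf A x) (hβy : β ≤ alphaf A y) :
    |((alphaf A x) ^ 2)⁻¹ - ((alphaf A y) ^ 2)⁻¹|
      ≤ 4 * (β ^ 3)⁻¹ * Real.sqrt n * R * Real.exp (R ^ 2) * vecNorm2 (x - y) := by
  have hR0 : (0:ℝ) ≤ R := by linarith
  have hn0 : ∀ {m : ℕ} (v : Fin m → ℝ), 0 ≤ vecNorm2 v := fun v => Real.sqrt_nonneg _
  have hc : ∀ z : Fin d → ℝ, vecNorm2 z ≤ R → ∀ j, A.mulVec z j ≤ R ^ 2 := by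
    intro z hz j
    calc A.mulVec z j ≤ vecNorm2 (A.mulVec z) := aux_coord _ j
      _ ≤ specNorm A * vecNorm2 z := aux_mulVec A z
      _ ≤ R * R := mul_le_mul hA hz (hn0 z) hR0
      _ = R ^ 2 := by ring
  have hE : 1 ≤ Real.exp (R ^ 2) := Real.one_le_exp (sq_nonneg R)
  have hα : |alphaf A x - alphaf A y|
      ≤ 2 * Real.exp (R ^ 2) * (Real.sqrt n * (R * vecNorm2 (x - y))) := by
    calc |alphaf A x - alphaf A y| = |∑ j, (uf A x j - uf A y j)| := by
          unfold alphaf; rw [Finset.sum_sub_distrib]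
      _ ≤ ∑ j, |uf A x j - uf A y j| := Finset.abs_sum_le_sum_abs _ _
      _ ≤ ∑ j, 2 * Real.exp (R ^ 2) * |A.mulVec (x - y) j| := by
          apply Finset.sum_le_sum
          intro j _
          have h1 := aux_exp _ _ _ (hc x hx j) (hc y hy j)
          have h2 : A.mulVec (x - y) j = A.mulVec x j - A.mulVec y j := by
            rw [Matrix.mulVec_sub]; rfl
          rw [h2]
          have h3 : uf A x j - uf A y j = (Real.exp (A.mulVec x j) - Real.exp (A.mulVec y j))
              + (A.mulVec x j - A.mulVec y j) := by
            simp only [uf, expv]; ring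
          rw [h3]
          have h4 := abs_add_le (Real.exp (A.mulVec x j) - Real.exp (A.mulVec y j))
            (A.mulVec x j - A.mulVec y j)
          have h5 := mul_le_mul_of_nonneg_right hE (abs_nonneg (A.mulVec x j - A.mulVec y j))
          linarith
      _ = 2 * Real.exp (R ^ 2) * ∑ j, |A.mulVec (x - y) j| := by rw [Finset.mul_sum]
      _ ≤ _ := by
          gcongr
          refine (aux_l1 _).trans ?_
          gcongr
          exact (aux_mulVec A _).trans (mul_le_mul_of_nonneg_right hA (hn0 _))
  refine (aux_inv _ _ β hβ0 hβx hβy).trans ?_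
  calc 2 * (β ^ 3)⁻¹ * |alphaf A x - alphaf A y|
      ≤ 2 * (β ^ 3)⁻¹ * (2 * Real.exp (R ^ 2) * (Real.sqrt n * (R * vecNorm2 (x - y)))) := by
        gcongr
    _ = _ := by ring
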